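/- Assume the generative model where in addition Z* has orthonormal rows, i.e. Z*(Z*)^T = Id, and let q := max_{1≤k≤n} ‖D_k Z* D̃_k‖_2. Suppose ε > 0 satisfies: ε < ε₁ := ½ min_{1≤j≤N} β(Z*_{(·,j)} / ‖Z*_{(·,j)}‖_2), ε < √2 − 1, and q̄ := q + C(ε)·ε < 1. Then for every initial orthogonal matrix W^0 with ‖W^0 − W*‖_F ≤ ε, the iterates of the alternating algorithm satisfy, for all t ≥ 1: ‖Z^t − Z*‖_F ≤ q̄^{t−1} ε and ‖W^t − W*‖_F ≤ q̄^t ε. -/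

import Mathlib

open Matrix MeasureTheory ProbabilityTheory Filter
open scoped Kronecker

noncomputable section

/-- Frobenius norm of a real matrix. -/
def frobNorm {m n : Type*} [Fintype m] [Fintype n] (M : Matrix m n ℝ) : ℝ :=
  Real.sqrt (∑ i, ∑ j, (M i j) ^ 2)

/-- Spectral norm (largest singular value) of a real matrix. -/
def specNorm {m n : Type*} [Fintype m] [Fintype n] [DecidableEq n] (M : Matrix m n ℝ) : ℝ :=
  ‖LinearMap.toContinuousLinearMap (Matrix.toEuclideanLin M)‖

/-- Smallest singular value of a real matrix (as the infimum of `‖Mᵀ x‖` over unit vectors). -/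
def sigmaMin {m n : Type*} [Fintype m] [Fintype n] [DecidableEq m] (M : Matrix m n ℝ) : ℝ :=
  sInf {c : ℝ | ∃ x : EuclideanSpace ℝ m, ‖x‖ = 1 ∧ c = ‖Matrix.toEuclideanLin Mᵀ x‖}

/-- Condition number: ratio of largest to smallest singular value. -/
def condNum {m n : Type*} [Fintype m] [Fintype n] [DecidableEq m] [DecidableEq n]
    (M : Matrix m n ℝ) : ℝ :=
  specNorm M / sigmaMin M

/-- `D_k`: diagonal matrix with ones on the diagonal except a zero at `(k,k)`. -/
def Dk {n : Type*} [Fintype n] [DecidableEq n] (k : n) : Matrix n n ℝ :=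
  Matrix.diagonal (fun i => if i = k then 0 else 1)

/-- `D̃_k`: diagonal matrix with ones at columns in the support of the `k`-th row of `Z`. -/
def Dtil {n N : Type*} [Fintype n] [Fintype N] [DecidableEq N]
    (Z : Matrix n N ℝ) (k : n) : Matrix N N ℝ :=
  Matrix.diagonal (fun j => if Z k j ≠ 0 then 1 else 0)

/-- `max_{1 ≤ k ≤ n} ‖D_k Z D̃_k‖₂`. -/
def qmax {n N : Type*} [Fintype n] [Fintype N] [DecidableEq n] [DecidableEq N]
    (Z : Matrix n N ℝ) : ℝ :=
  ⨆ k : n, specNorm (Dk k * Z * Dtil Z k)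

/-- `z = H_s(v)`: hard thresholding of `v` to its `s` largest-magnitude entries. -/
def IsHardThresh {n : ℕ} (s : ℕ) (v z : Fin n → ℝ) : Prop :=
  ∃ T : Finset (Fin n), T.card = s ∧ (∀ i ∈ T, ∀ j ∉ T, |v j| ≤ |v i|) ∧
    (∀ i ∈ T, z i = v i) ∧ (∀ i ∉ T, z i = 0)

/-- Euclidean norm of a vector. -/
def l2norm {n : ℕ} (v : Fin n → ℝ) : ℝ := Real.sqrt (∑ i, (v i) ^ 2)

/-- `β(v)`: smallest magnitude among the nonzero entries of `v`. -/
def betaMin {n : ℕ} (v : Fin n → ℝ) : ℝ :=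
  sInf {c : ℝ | ∃ i, v i ≠ 0 ∧ c = |v i|}

/-- The constant `C(ε₀)` from the convergence-radius analysis. -/
def Cconst (e : ℝ) : ℝ :=
  2 + 9 * Real.sqrt 2 / (8 * (1 - 2 * e - e ^ 2) ^ ((3 : ℝ) / 2)) + Real.sqrt 2 / (1 - e)

end

open scoped Matrix.Norms.Frobenius in
theorem frobNorm_eq_norm {m n : Type*} [Fintype m] [Fintype n] (M : Matrix m n ℝ) :
    frobNorm M = ‖M‖ := by
  rw [Matrix.frobenius_norm_def, frobNorm, Real.sqrt_eq_rpow]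
  simp

theorem frobNorm_nonneg {m n : Type*} [Fintype m] [Fintype n] (M : Matrix m n ℝ) :
    0 ≤ frobNorm M := Real.sqrt_nonneg _

theorem frobNorm_sq {m n : Type*} [Fintype m] [Fintype n] (M : Matrix m n ℝ) :
    frobNorm M ^ 2 = ∑ i, ∑ j, M i j ^ 2 :=
  Real.sq_sqrt (by positivity)

theorem frobNorm_sq_eq_trace {m n : Type*} [Fintype m] [Fintype n] (M : Matrix m n ℝ) :
    frobNorm M ^ 2 = trace (M * Mᵀ) := by
  rw [frobNorm_sq]
  simp [trace, Matrix.mul_apply, pow_two]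

open scoped Matrix.Norms.Frobenius in
theorem frobNorm_add_le {m n : Type*} [Fintype m] [Fintype n] (A B : Matrix m n ℝ) :
    frobNorm (A + B) ≤ frobNorm A + frobNorm B := by
  simpa only [frobNorm_eq_norm] using norm_add_le A B

open scoped Matrix.Norms.Frobenius in
theorem frobNorm_sub_le {m n : Type*} [Fintype m] [Fintype n] (A B : Matrix m n ℝ) :
    frobNorm (A - B) ≤ frobNorm A + frobNorm B := by
  simpa only [frobNorm_eq_norm] using norm_sub_le A B

open scoped Matrix.Norms.Frobenius in
theorem frobNorm_mul_le {l m n : Type*} [Fintype l] [Fintype m] [Fintype n]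
    (A : Matrix l m ℝ) (B : Matrix m n ℝ) :
    frobNorm (A * B) ≤ frobNorm A * frobNorm B := by
  simpa only [frobNorm_eq_norm] using Matrix.frobenius_norm_mul A B

theorem frobNorm_transpose {m n : Type*} [Fintype m] [Fintype n] (A : Matrix m n ℝ) :
    frobNorm Aᵀ = frobNorm A := by
  rw [frobNorm, frobNorm, Finset.sum_comm]
  rfl

open scoped Matrix.Norms.Frobenius in
theorem frobNorm_smul {m n : Type*} [Fintype m] [Fintype n] (c : ℝ) (A : Matrix m n ℝ) :
    frobNorm (c • A) = |c| * frobNorm A := by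
  rw [frobNorm_eq_norm, frobNorm_eq_norm, norm_smul, Real.norm_eq_abs]

theorem frobNorm_mul_of_mul_transpose_eq_one {l m n : Type*} [Fintype l] [Fintype m] [Fintype n]
    [DecidableEq m] (X : Matrix l m ℝ) {Z : Matrix m n ℝ} (hZ : Z * Zᵀ = 1) :
    frobNorm (X * Z) = frobNorm X := by
  rw [← sq_eq_sq₀ (frobNorm_nonneg _) (frobNorm_nonneg _), frobNorm_sq_eq_trace,
    frobNorm_sq_eq_trace, transpose_mul, Matrix.mul_assoc, ← Matrix.mul_assoc Z, hZ,
    Matrix.one_mul]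

theorem frobNorm_mul_transpose_le {l m n : Type*} [Fintype l] [Fintype m] [Fintype n]
    [DecidableEq m] (X : Matrix l n ℝ) {Z : Matrix m n ℝ} (hZ : Z * Zᵀ = 1) :
    frobNorm (X * Zᵀ) ≤ frobNorm X := by
  refine le_of_sq_le_sq ?_ (frobNorm_nonneg _)
  have h := sq_nonneg (frobNorm (X - X * Zᵀ * Z))
  have hexp : (X - X * Zᵀ * Z) * (X - X * Zᵀ * Z)ᵀ = X * Xᵀ - X * Zᵀ * (X * Zᵀ)ᵀ := by
    have h1 : X * Zᵀ * Z * (Zᵀ * (Z * Xᵀ)) = X * Zᵀ * (Z * Xᵀ) := by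
      rw [Matrix.mul_assoc _ Z, ← Matrix.mul_assoc Z, hZ, Matrix.one_mul]
    simp only [transpose_sub, transpose_mul, transpose_transpose, Matrix.sub_mul, Matrix.mul_sub,
      h1]
    simp only [Matrix.mul_assoc]
    abel
  rw [frobNorm_sq_eq_trace, hexp, trace_sub, ← frobNorm_sq_eq_trace, ← frobNorm_sq_eq_trace] at h
  linarith

/-- The square of the Frobenius distance, expanded. -/
theorem frobNorm_sub_sq {m n : Type*} [Fintype m] [Fintype n] (A B : Matrix m n ℝ) :
    frobNorm (A - B) ^ 2 = frobNorm A ^ 2 - 2 * trace (A * Bᵀ) + frobNorm B ^ 2 := by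
  have h : trace (B * Aᵀ) = trace (A * Bᵀ) := by
    rw [← trace_transpose, transpose_mul, transpose_transpose]
  simp only [frobNorm_sq_eq_trace, transpose_sub, Matrix.sub_mul, Matrix.mul_sub, trace_sub, h]
  ring

theorem abs_mul_apply_le {n N : ℕ} (X : Matrix (Fin n) (Fin n) ℝ) (Z : Matrix (Fin n) (Fin N) ℝ)
    (i : Fin n) (j : Fin N) :
    |(X * Z) i j| ≤ frobNorm X * l2norm (fun k => Z k j) := by
  refine abs_le_of_sq_le_sq ?_ (mul_nonneg (frobNorm_nonneg _) (Real.sqrt_nonneg _))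
  rw [mul_pow, frobNorm_sq, l2norm, Real.sq_sqrt (by positivity), Matrix.mul_apply]
  refine (Finset.sum_mul_sq_le_sq_mul_sq _ _ _).trans ?_
  refine mul_le_mul_of_nonneg_right ?_ (by positivity)
  exact Finset.single_le_sum (f := fun i => ∑ k, X i k ^ 2) (fun _ _ => by positivity)
    (Finset.mem_univ i)

/-- Hard thresholding of a small perturbation of an `s`-sparse vector recovers the support. -/
theorem IsHardThresh.eq_ite_of_close {n s : ℕ} {z v w : Fin n → ℝ} {b : ℝ}
    (h : IsHardThresh s v w) (hv : ∀ i, |v i - z i| ≤ b) (hz : ∀ i, z i ≠ 0 → 2 * b < |z i|)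
    (hs : (Finset.univ.filter (fun i => z i ≠ 0)).card = s) (i : Fin n) :
    w i = if z i ≠ 0 then v i else 0 := by
  obtain ⟨T, hT, hord, hin, hout⟩ := h
  have hsub : T ⊆ Finset.univ.filter (fun i => z i ≠ 0) := by
    by_contra hnot
    obtain ⟨j, hjT, hj⟩ := Finset.not_subset.mp hnot
    have : ¬ (Finset.univ.filter (fun i => z i ≠ 0)) ⊆ T := fun hc =>
      hnot (Finset.eq_of_subset_of_card_le hc (by omega)).ge
    obtain ⟨k, hk, hkT⟩ := Finset.not_subset.mp this
    simp only [Finset.mem_filter, Finset.mem_univ, true_and, not_not] at hj hk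
    have h1 := hord j hjT k hkT
    have h2 := hv j
    rw [hj, sub_zero] at h2
    have h3 := hv k
    have h4 := hz k hk
    have h5 := abs_sub_abs_le_abs_sub (z k) (v k)
    rw [abs_sub_comm] at h5
    linarith
  have hTeq := Finset.eq_of_subset_of_card_le hsub (by omega)
  by_cases hi : z i ≠ 0
  · rw [if_pos hi]
    exact hin i (by rw [hTeq]; simpa using hi)
  · rw [if_neg hi]
    exact hout i (by rw [hTeq]; simpa using hi)

/-- The entries of `X * Z` on the support of `Z`. -/
noncomputable def maskedMul {n N : Type*} [Fintype n] (Z : Matrix n N ℝ) (X : Matrix n n ℝ) : Matrix n N ℝ :=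
  Matrix.of fun i j => if Z i j ≠ 0 then (X * Z) i j else 0

theorem maskedMul_add {n N : Type*} [Fintype n] (Z : Matrix n N ℝ) (X Y : Matrix n n ℝ) :
    maskedMul Z (X + Y) = maskedMul Z X + maskedMul Z Y := by
  ext i j
  simp only [maskedMul, Matrix.of_apply, Matrix.add_apply, Matrix.add_mul]
  split_ifs <;> simp

theorem frobNorm_maskedMul_le {n N : Type*} [Fintype n] [Fintype N] [DecidableEq n]
    {Z : Matrix n N ℝ} (hZ : Z * Zᵀ = 1) (X : Matrix n n ℝ) :
    frobNorm (maskedMul Z X) ≤ frobNorm X := by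
  rw [← frobNorm_mul_of_mul_transpose_eq_one X hZ]
  refine Real.sqrt_le_sqrt ?_
  refine Finset.sum_le_sum fun i _ => Finset.sum_le_sum fun j _ => ?_
  rw [maskedMul, Matrix.of_apply]
  split_ifs
  · exact le_rfl
  · simpa using sq_nonneg ((X * Z) i j)

theorem specNorm_le_qmax {n N : Type*} [Fintype n] [Fintype N] [DecidableEq n] [DecidableEq N]
    (Z : Matrix n N ℝ) (k : n) : specNorm (Dk k * Z * Dtil Z k) ≤ qmax Z :=
  le_ciSup (f := fun k => specNorm (Dk k * Z * Dtil Z k)) (Set.finite_range _).bddAbove k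

theorem qmax_nonneg {n N : Type*} [Fintype n] [Fintype N] [DecidableEq n] [DecidableEq N]
    (Z : Matrix n N ℝ) : 0 ≤ qmax Z :=
  Real.iSup_nonneg fun _ => norm_nonneg _

open scoped Matrix.Norms.L2Operator in
theorem sum_vecMul_sq_le {m n : Type*} [Fintype m] [Fintype n] [DecidableEq m] [DecidableEq n]
    (M : Matrix m n ℝ) (x : m → ℝ) :
    ∑ j, (x ᵥ* M) j ^ 2 ≤ specNorm M ^ 2 * ∑ i, x i ^ 2 := by
  have h := Matrix.l2_opNorm_mulVec Mᵀ (WithLp.toLp 2 x)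
  have h2 : ‖Mᵀ‖ = specNorm M := by
    rw [← conjTranspose_eq_transpose_of_trivial, Matrix.l2_opNorm_conjTranspose]
    rfl
  rw [h2, EuclideanSpace.norm_eq, EuclideanSpace.norm_eq] at h
  have h3 := pow_le_pow_left₀ (Real.sqrt_nonneg _) h 2
  rw [mul_pow, Real.sq_sqrt (by positivity), Real.sq_sqrt (by positivity)] at h3
  simpa [Matrix.mulVec_transpose] using h3

/-- On matrices with zero diagonal, masking contracts by the factor `qmax Z`. -/
theorem frobNorm_maskedMul_le_qmax {n N : Type*} [Fintype n] [Fintype N] [DecidableEq n]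
    [DecidableEq N] (Z : Matrix n N ℝ) {K : Matrix n n ℝ} (hK : ∀ k, K k k = 0) :
    frobNorm (maskedMul Z K) ≤ qmax Z * frobNorm K := by
  refine le_of_sq_le_sq ?_ (mul_nonneg (qmax_nonneg Z) (frobNorm_nonneg _))
  rw [mul_pow, frobNorm_sq, frobNorm_sq, Finset.mul_sum]
  refine Finset.sum_le_sum fun k _ => ?_
  have hrow : ∀ j, maskedMul Z K k j = (K k ᵥ* (Dk k * Z * Dtil Z k)) j := by
    intro j
    have hKD : K k ᵥ* Dk k = K k := by
      ext i
      rw [Dk, Matrix.vecMul_diagonal]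
      by_cases hi : i = k
      · simp [hi, hK]
      · simp [hi]
    rw [← Matrix.vecMul_vecMul, ← Matrix.vecMul_vecMul, hKD, Dtil, Matrix.vecMul_diagonal,
      maskedMul, Matrix.of_apply, Matrix.mul_apply_eq_vecMul]
    split_ifs <;> simp
  simp only [hrow]
  refine (sum_vecMul_sq_le _ _).trans ?_
  gcongr
  · exact norm_nonneg _
  · exact specNorm_le_qmax Z k

/-- Rotation by `(c, s)` in the plane of the coordinates `i` and `j`. -/
noncomputable def planeRotation {n : Type*} [DecidableEq n] (i j : n) (c s : ℝ) : Matrix n n ℝ :=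
  1 + (c - 1) • (single i i 1 + single j j 1) + s • (single i j 1 - single j i 1)

theorem planeRotation_transpose_mul_self {n : Type*} [Fintype n] [DecidableEq n] {i j : n}
    (hij : i ≠ j) {c s : ℝ} (hcs : c ^ 2 + s ^ 2 = 1) :
    (planeRotation i j c s)ᵀ * planeRotation i j c s = 1 := by
  set D : Matrix n n ℝ := single i i 1 + single j j 1 with hD
  set J : Matrix n n ℝ := single i j 1 - single j i 1 with hJ
  have hDT : Dᵀ = D := by simp [hD]
  have hJT : Jᵀ = -J := by simp [hJ]
  have hDD : D * D = D := by simp [hD, Matrix.add_mul, Matrix.mul_add, hij, hij.symm]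
  have hDJ : D * J = J := by
    simp [hD, hJ, Matrix.add_mul, Matrix.mul_sub, hij, hij.symm]
  have hJD : J * D = J := by
    simp [hD, hJ, Matrix.sub_mul, Matrix.mul_add, hij, hij.symm]
    abel
  have hJJ : J * J = -D := by
    simp [hD, hJ, Matrix.sub_mul, Matrix.mul_sub, hij, hij.symm]
    abel
  have hG : planeRotation i j c s = 1 + (c - 1) • D + s • J := rfl
  rw [hG]
  simp only [transpose_add, transpose_smul, transpose_one, hDT, hJT, Matrix.add_mul,
    Matrix.mul_add, Matrix.one_mul, Matrix.mul_one, Matrix.smul_mul, Matrix.mul_smul,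
    Matrix.neg_mul, hDD, hDJ, hJD, hJJ]
  match_scalars <;> first | ring1 | linear_combination hcs

/-- If the identity maximizes `O ↦ trace (O * H)` over orthogonal matrices, then `H` is
symmetric. -/
theorem transpose_eq_self_of_trace_mul_le {n : Type*} [Fintype n] [DecidableEq n]
    {H : Matrix n n ℝ} (hH : ∀ O : Matrix n n ℝ, Oᵀ * O = 1 → trace (O * H) ≤ trace H) :
    Hᵀ = H := by
  ext i j
  rw [transpose_apply]
  by_cases hij : i = j
  · rw [hij]
  have hle : ∀ c s : ℝ, c ^ 2 + s ^ 2 = 1 →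
      (c - 1) * (H i i + H j j) + s * (H j i - H i j) ≤ 0 := by
    intro c s hcs
    have h := hH _ (planeRotation_transpose_mul_self hij hcs)
    simp only [planeRotation, Matrix.add_mul, Matrix.sub_mul, Matrix.smul_mul,
      trace_add, trace_sub, trace_smul, trace_single_mul, smul_eq_mul, one_mul] at h
    linarith
  set a := H i i + H j j
  set b := H j i - H i j with hb
  have ht : ∀ t : ℝ, t * b ≤ t ^ 2 * a := by
    intro t
    have hpos : 0 < 1 + t ^ 2 := by positivity
    have h := hle ((1 - t ^ 2) / (1 + t ^ 2)) (2 * t / (1 + t ^ 2)) (by field_simp; ring)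
    have h2 : ((1 - t ^ 2) / (1 + t ^ 2) - 1) * a + 2 * t / (1 + t ^ 2) * b
        = 2 * (t * b - t ^ 2 * a) / (1 + t ^ 2) := by field_simp; ring
    rw [h2, div_le_iff₀ hpos] at h
    linarith
  have hb0 : b = 0 := by
    have hpos : 0 < |a| + 1 := by positivity
    have h := ht (b / (|a| + 1))
    have h2 : b ^ 2 * (|a| + 1) ≤ b ^ 2 * a := by
      have := mul_le_mul_of_nonneg_right h (sq_nonneg (|a| + 1))
      field_simp at this
      linarith
    have h3 := mul_le_mul_of_nonneg_left (le_abs_self a) (sq_nonneg b)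
    exact pow_eq_zero_iff two_ne_zero |>.mp (le_antisymm (by linarith) (sq_nonneg b))
  linarith

/-- The symmetric part of `Q - 1` for orthogonal `Q` is quadratically small. -/
theorem sub_one_add_transpose_of_orthogonal {n : Type*} [Fintype n] [DecidableEq n]
    {Q : Matrix n n ℝ} (hQ : Qᵀ * Q = 1) :
    (Q - 1) + (Q - 1)ᵀ = -((Q - 1)ᵀ * (Q - 1)) := by
  simp only [transpose_sub, transpose_one, Matrix.sub_mul, Matrix.mul_sub, Matrix.one_mul,
    Matrix.mul_one, hQ]
  abel

/-- Masking `(Q - 1) * Z` for orthogonal `Q` contracts by `qmax Z` up to a quadratic error. -/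
theorem frobNorm_maskedMul_sub_one_le {n N : Type*} [Fintype n] [Fintype N] [DecidableEq n]
    [DecidableEq N] {Z : Matrix n N ℝ} (hZ : Z * Zᵀ = 1) {Q : Matrix n n ℝ} (hQ : Qᵀ * Q = 1) :
    frobNorm (maskedMul Z (Q - 1)) ≤
      qmax Z * frobNorm (Q - 1) + frobNorm (Q - 1) ^ 2 / 2 := by
  set X := Q - 1 with hX
  set K : Matrix n n ℝ := (1 / 2 : ℝ) • (X - Xᵀ) with hK
  set S : Matrix n n ℝ := (1 / 2 : ℝ) • (X + Xᵀ) with hS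
  have hXKS : X = K + S := by
    rw [hK, hS]
    module
  have hKn : frobNorm K ≤ frobNorm X := by
    have h := frobNorm_sub_le X Xᵀ
    rw [frobNorm_transpose] at h
    rw [hK, frobNorm_smul, abs_of_pos (by norm_num)]
    linarith
  have hSn : frobNorm S ≤ frobNorm X ^ 2 / 2 := by
    have h := frobNorm_mul_le Xᵀ X
    rw [frobNorm_transpose] at h
    rw [hS, hX, sub_one_add_transpose_of_orthogonal hQ, ← hX, smul_neg, ← neg_smul, frobNorm_smul,
      abs_neg, abs_of_pos (by norm_num)]
    linarith
  calc frobNorm (maskedMul Z X) = frobNorm (maskedMul Z K + maskedMul Z S) := by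
        rw [← maskedMul_add, ← hXKS]
    _ ≤ frobNorm (maskedMul Z K) + frobNorm (maskedMul Z S) := frobNorm_add_le _ _
    _ ≤ qmax Z * frobNorm K + frobNorm S :=
        add_le_add (frobNorm_maskedMul_le_qmax Z fun k => by simp [hK])
          (frobNorm_maskedMul_le hZ S)
    _ ≤ qmax Z * frobNorm X + frobNorm X ^ 2 / 2 := by
        gcongr
        exact qmax_nonneg Z

/-- Perturbation bound for the orthogonal Procrustes problem near the identity. -/
theorem frobNorm_procrustes_sub_one_le {n N : Type*} [Fintype n] [Fintype N] [DecidableEq n]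
    {Z Y : Matrix n N ℝ} (hZ : Z * Zᵀ = 1) {R : Matrix n n ℝ} (hR : Rᵀ * R = 1)
    (hmin : ∀ O : Matrix n n ℝ, Oᵀ * O = 1 → frobNorm (R * Z - Y) ≤ frobNorm (O * Z - Y)) :
    frobNorm (R - 1) ≤ frobNorm (Y - Z) + 4 * frobNorm (Y - Z) ^ 2 := by
  set E := (Y - Z) * Zᵀ with hE
  set Δ := R - 1 with hΔ
  have hEn : frobNorm E ≤ frobNorm (Y - Z) := frobNorm_mul_transpose_le _ hZ
  have hΔn : frobNorm Δ ≤ 2 * frobNorm (Y - Z) := by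
    have h1 := hmin 1 (by simp)
    rw [Matrix.one_mul, ← neg_sub Y Z, ← neg_one_smul ℝ (Y - Z), frobNorm_smul, abs_neg, abs_one,
      one_mul] at h1
    rw [← frobNorm_mul_of_mul_transpose_eq_one Δ hZ]
    have h2 : Δ * Z = (R * Z - Y) + (Y - Z) := by
      rw [hΔ, Matrix.sub_mul, Matrix.one_mul]
      abel
    rw [h2]
    linarith [frobNorm_add_le (R * Z - Y) (Y - Z)]
  have hY : Z * Yᵀ = 1 + Eᵀ := by
    rw [hE, transpose_mul, transpose_transpose, transpose_sub, Matrix.mul_sub, hZ]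
    abel
  have htr : ∀ O : Matrix n n ℝ, Oᵀ * O = 1 → trace (O * (Z * Yᵀ)) ≤ trace (R * (Z * Yᵀ)) := by
    intro O hO
    have h := pow_le_pow_left₀ (frobNorm_nonneg _) (hmin O hO) 2
    have hOR : frobNorm R ^ 2 = frobNorm O ^ 2 := by
      rw [frobNorm_sq_eq_trace, frobNorm_sq_eq_trace, trace_mul_comm, hR, trace_mul_comm O, hO]
    rw [frobNorm_sub_sq, frobNorm_sub_sq, frobNorm_mul_of_mul_transpose_eq_one _ hZ,
      frobNorm_mul_of_mul_transpose_eq_one _ hZ, hOR, Matrix.mul_assoc, Matrix.mul_assoc] at h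
    linarith
  have hsym : (Z * Yᵀ * R)ᵀ = Z * Yᵀ * R := by
    refine transpose_eq_self_of_trace_mul_le fun O hO => ?_
    have h := htr (R * O) (by
      rw [transpose_mul, Matrix.mul_assoc, ← Matrix.mul_assoc Rᵀ, hR, Matrix.one_mul, hO])
    rwa [Matrix.mul_assoc, trace_mul_comm R, trace_mul_comm R, Matrix.mul_assoc] at h
  have hRΔ : R = 1 + Δ := by rw [hΔ]; abel
  have hskew : Δ - Δᵀ = E - Eᵀ + (Δᵀ * E - Eᵀ * Δ) := by
    rw [hY, hRΔ] at hsym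
    simp only [transpose_add, transpose_mul, transpose_one, transpose_transpose, Matrix.add_mul,
      Matrix.mul_add, Matrix.one_mul, Matrix.mul_one] at hsym
    linear_combination (norm := abel) -hsym
  have htwo : (2 : ℝ) • Δ = (E - Eᵀ) + ((Δᵀ * E - Eᵀ * Δ) - Δᵀ * Δ) := by
    have h1 := sub_one_add_transpose_of_orthogonal hR
    rw [← hΔ] at h1
    rw [two_smul]
    linear_combination (norm := abel) hskew + h1
  have hb : 2 * frobNorm Δ ≤ 2 * frobNorm E + (2 * (frobNorm Δ * frobNorm E) + frobNorm Δ ^ 2) := by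
    have h0 : frobNorm ((2 : ℝ) • Δ) = 2 * frobNorm Δ := by
      rw [frobNorm_smul, abs_of_pos two_pos]
    rw [← h0, htwo]
    have h1 := frobNorm_add_le (E - Eᵀ) ((Δᵀ * E - Eᵀ * Δ) - Δᵀ * Δ)
    have h2 := frobNorm_sub_le E Eᵀ
    have h3 := frobNorm_sub_le (Δᵀ * E - Eᵀ * Δ) (Δᵀ * Δ)
    have h4 := frobNorm_sub_le (Δᵀ * E) (Eᵀ * Δ)
    have h5 := frobNorm_mul_le Δᵀ E
    have h6 := frobNorm_mul_le Eᵀ Δ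
    have h7 := frobNorm_mul_le Δᵀ Δ
    rw [frobNorm_transpose] at h2 h5 h6 h7
    linarith
  have hmul : frobNorm Δ * frobNorm E ≤ 2 * frobNorm (Y - Z) * frobNorm (Y - Z) :=
    mul_le_mul hΔn hEn (frobNorm_nonneg _) (by linarith [frobNorm_nonneg (Y - Z)])
  have hsq := pow_le_pow_left₀ (frobNorm_nonneg _) hΔn 2
  linarith

theorem nine_halves_le_Cconst {e : ℝ} (he0 : 0 < e) (he : e < Real.sqrt 2 - 1) :
    9 / 2 ≤ Cconst e := by
  have hs : (1.4 : ℝ) ≤ Real.sqrt 2 := Real.le_sqrt_of_sq_le (by norm_num)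
  have hs2 : Real.sqrt 2 ^ 2 = 2 := Real.sq_sqrt (by norm_num)
  have hs3 : Real.sqrt 2 < 2 := by nlinarith
  have hpos : 0 < 1 - 2 * e - e ^ 2 := by nlinarith
  have hrp : (1 - 2 * e - e ^ 2) ^ ((3 : ℝ) / 2) ≤ 1 :=
    Real.rpow_le_one hpos.le (by nlinarith) (by norm_num)
  have hrp0 := Real.rpow_pos_of_pos hpos ((3 : ℝ) / 2)
  have h1 : 9 * Real.sqrt 2 / 8 ≤
      9 * Real.sqrt 2 / (8 * (1 - 2 * e - e ^ 2) ^ ((3 : ℝ) / 2)) := by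
    gcongr
    linarith
  have h2 : Real.sqrt 2 ≤ Real.sqrt 2 / (1 - e) :=
    le_div_self (Real.sqrt_nonneg _) (by linarith) (by linarith)
  unfold Cconst
  linarith

theorem betaMin_le {n : ℕ} {v : Fin n → ℝ} {i : Fin n} (hi : v i ≠ 0) : betaMin v ≤ |v i| :=
  csInf_le ⟨0, by rintro _ ⟨k, -, rfl⟩; exact abs_nonneg _⟩ ⟨i, hi, rfl⟩

theorem two_mul_l2norm_lt_abs {n N : ℕ} {Z : Matrix (Fin n) (Fin N) ℝ} {ε : ℝ}
    (hε : ε < (1 / 2) * ⨅ j : Fin N, betaMin (fun i => Z i j / l2norm (fun i => Z i j)))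
    {i : Fin n} {j : Fin N} (hij : Z i j ≠ 0) :
    2 * (ε * l2norm (fun i => Z i j)) < |Z i j| := by
  have hl : 0 < l2norm (fun i => Z i j) :=
    Real.sqrt_pos.mpr (Finset.sum_pos' (fun _ _ => sq_nonneg _)
      ⟨i, Finset.mem_univ i, by positivity⟩)
  have h1 := ciInf_le (f := fun j : Fin N => betaMin (fun i => Z i j / l2norm (fun i => Z i j)))
    (Set.finite_range _).bddBelow j
  have h2 := betaMin_le (v := fun i => Z i j / l2norm (fun i => Z i j)) (i := i)
    (div_ne_zero hij hl.ne')
  simp only [abs_div, abs_of_pos hl] at h2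
  have h3 : 2 * ε < |Z i j| / l2norm (fun i => Z i j) := by linarith
  rw [lt_div_iff₀ hl] at h3
  linarith

/-- explicit convergence radius for the orthonormal-rows case. -/
theorem stmt2 (n N s : ℕ) (hs : 1 ≤ s) (hsn : s ≤ n)
    (Wstar : Matrix (Fin n) (Fin n) ℝ) (Zstar P : Matrix (Fin n) (Fin N) ℝ)
    (hWorth : Wstarᵀ * Wstar = 1)
    (hP : P = Wstarᵀ * Zstar)
    (hPnorm : specNorm P = 1)
    (hcols : ∀ j, (Finset.univ.filter (fun i => Zstar i j ≠ 0)).card = s)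
    (hrows : Zstar * Zstarᵀ = 1)
    (ε qbar : ℝ) (hε0 : 0 < ε)
    (hε1 : ε < (1 / 2) * ⨅ j : Fin N,
      betaMin (fun i => Zstar i j / l2norm (fun i => Zstar i j)))
    (hε2 : ε < Real.sqrt 2 - 1)
    (hqbar : qbar = qmax Zstar + Cconst ε * ε)
    (hqbar1 : qbar < 1) :
    ∀ W0 : Matrix (Fin n) (Fin n) ℝ,
      W0ᵀ * W0 = 1 → frobNorm (W0 - Wstar) ≤ ε →
      ∀ (Zs : ℕ → Matrix (Fin n) (Fin N) ℝ) (Ws : ℕ → Matrix (Fin n) (Fin n) ℝ),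
        Ws 0 = W0 →
        (∀ t j, IsHardThresh s (fun i => (Ws t * P) i j) (fun i => Zs (t + 1) i j)) →
        (∀ t, (Ws (t + 1))ᵀ * Ws (t + 1) = 1 ∧
          ∀ W' : Matrix (Fin n) (Fin n) ℝ, W'ᵀ * W' = 1 →
            frobNorm (Ws (t + 1) * P - Zs (t + 1)) ≤ frobNorm (W' * P - Zs (t + 1))) →
        ∀ t : ℕ, frobNorm (Zs (t + 1) - Zstar) ≤ qbar ^ t * ε ∧
          frobNorm (Ws (t + 1) - Wstar) ≤ qbar ^ (t + 1) * ε := by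

  intro W0 hW0 hW0ε Zs Ws hWs0 hthr hproc
  have hWorth' : Wstar * Wstarᵀ = 1 := mul_eq_one_comm.mp hWorth
  have hC := nine_halves_le_Cconst hε0 hε2
  have hq0 : 0 ≤ qbar := by
    rw [hqbar]
    have := qmax_nonneg Zstar
    positivity
  have horth : ∀ t, (Ws t)ᵀ * Ws t = 1 := by
    rintro (_ | t)
    · rw [hWs0, hW0]
    · exact (hproc t).1
  have horthQ : ∀ t, (Ws t * Wstarᵀ)ᵀ * (Ws t * Wstarᵀ) = 1 := by
    intro t
    rw [transpose_mul, transpose_transpose, Matrix.mul_assoc, ← Matrix.mul_assoc (Ws t)ᵀ, horth,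
      Matrix.one_mul, hWorth']
  have hWP : ∀ W : Matrix (Fin n) (Fin n) ℝ, W * P = W * Wstarᵀ * Zstar := fun W => by
    rw [hP, Matrix.mul_assoc]
  have hnorm : ∀ W : Matrix (Fin n) (Fin n) ℝ,
      frobNorm (W * Wstarᵀ - 1) = frobNorm (W - Wstar) := by
    intro W
    rw [← frobNorm_mul_of_mul_transpose_eq_one (W - Wstar)
      (show Wstarᵀ * Wstarᵀᵀ = 1 by rw [transpose_transpose, hWorth]), Matrix.sub_mul, hWorth']
  have hstep : ∀ t, frobNorm (Ws t - Wstar) ≤ ε →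
      frobNorm (Zs (t + 1) - Zstar) ≤ frobNorm (Ws t - Wstar) ∧
      frobNorm (Ws (t + 1) - Wstar) ≤ qbar * frobNorm (Ws t - Wstar) := by
    intro t ht
    have hmask : Zs (t + 1) - Zstar = maskedMul Zstar (Ws t * Wstarᵀ - 1) := by
      have hXZ : (Ws t * Wstarᵀ - 1) * Zstar = Ws t * P - Zstar := by
        rw [hWP, Matrix.sub_mul, Matrix.one_mul]
      ext i j
      have hent := (hthr t j).eq_ite_of_close (z := fun i => Zstar i j)
        (b := ε * l2norm (fun i => Zstar i j)) (fun i => by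
          have h := abs_mul_apply_le (Ws t * Wstarᵀ - 1) Zstar i j
          rw [hXZ, hnorm] at h
          exact h.trans (mul_le_mul_of_nonneg_right ht (Real.sqrt_nonneg _)))
        (fun i hi => two_mul_l2norm_lt_abs hε1 hi) (hcols j) i
      rw [Matrix.sub_apply, hent, maskedMul, Matrix.of_apply, hXZ, Matrix.sub_apply]
      split_ifs with h
      · rfl
      · simpa using h
    have h1 := frobNorm_maskedMul_le hrows (Ws t * Wstarᵀ - 1)
    have h2 := frobNorm_maskedMul_sub_one_le hrows (horthQ t)
    rw [← hmask, hnorm] at h1 h2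
    have h3 := frobNorm_procrustes_sub_one_le (Y := Zs (t + 1)) hrows (horthQ (t + 1))
      fun O hO => by
        have h := (hproc t).2 (O * Wstar) (by
          rw [transpose_mul, Matrix.mul_assoc, ← Matrix.mul_assoc Oᵀ, hO, Matrix.one_mul, hWorth])
        rwa [hWP, hWP, Matrix.mul_assoc O, hWorth', Matrix.mul_one] at h
    rw [hnorm] at h3
    have hd0 := frobNorm_nonneg (Ws t - Wstar)
    have h4 := pow_le_pow_left₀ (frobNorm_nonneg _) h1 2
    have h5 : 9 / 2 * frobNorm (Ws t - Wstar) ≤ Cconst ε * ε :=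
      mul_le_mul hC ht hd0 (by linarith)
    have h6 := mul_le_mul_of_nonneg_right h5 hd0
    refine ⟨h1, ?_⟩
    rw [hqbar]
    linarith
  have hW : ∀ t, frobNorm (Ws t - Wstar) ≤ qbar ^ t * ε := by
    intro t
    induction t with
    | zero => simpa [hWs0] using hW0ε
    | succ t ih =>
      have hle : frobNorm (Ws t - Wstar) ≤ ε :=
        ih.trans (mul_le_of_le_one_left hε0.le (pow_le_one₀ hq0 hqbar1.le))
      calc frobNorm (Ws (t + 1) - Wstar) ≤ qbar * frobNorm (Ws t - Wstar) := (hstep t hle).2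
        _ ≤ qbar * (qbar ^ t * ε) := mul_le_mul_of_nonneg_left ih hq0
        _ = qbar ^ (t + 1) * ε := by ring
  intro t
  exact ⟨(hstep t ((hW t).trans (mul_le_of_le_one_left hε0.le
    (pow_le_one₀ hq0 hqbar1.le)))).1.trans (hW t), hW (t + 1)⟩
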